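/- arXiv:2502.01827 — 7 statements merged into one kernel-verified Lean document; each statement's English description precedes it below -/
import Mathlib

section
/- Let p0, p1 ∈ (0,1), γ ∈ [0,1), δ ∈ (0,1), b ≥ 0. Suppose (μ0, μ1) is a feasible pair for problem P1 with total masses d0 = μ0([0,1]) > 0 and d1 = μ1([0,1]) > 0, and define the barycenters a0* = (∫ a dμ0(a))/d0 and a1* = (∫ a dμ1(a))/d1. Then the tuple (a0*, a1*, d0, d1) is feasible for problem P2, and d0·H(a0*) + d1·H(a1*) ≥ ∫ H(a) dμ0(a) + ∫ H(a) dμ1(a). -/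
open MeasureTheory Set

/-- Binary entropy function (natural log, `Real.log 0 = 0` gives the `0 log 0 = 0` convention). -/
noncomputable def binEnt (a : ℝ) : ℝ := -a * Real.log a - (1 - a) * Real.log (1 - a)

/-- Feasibility for problem P1 (measure form). -/
def FeasP1 (p0 p1 γ δ b : ℝ) (μ0 μ1 : Measure ℝ) : Prop :=
  IsFiniteMeasure μ0 ∧ IsFiniteMeasure μ1 ∧
    μ0 (Set.Icc (0:ℝ) 1)ᶜ = 0 ∧ μ1 (Set.Icc (0:ℝ) 1)ᶜ = 0 ∧
    (∫ a, (1 - γ * a) ∂μ0) - γ * (∫ a, a ∂μ1) = (1 - γ) * δ ∧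
    (μ0 Set.univ).toReal + (μ1 Set.univ).toReal = 1 ∧
    2 * (∫ a, |a - p0| ∂μ0) + 2 * (∫ a, |a - p1| ∂μ1) ≤ b

/-- Feasibility for problem P2. -/
def FeasP2 (p0 p1 γ δ b a0 a1 d0 d1 : ℝ) : Prop :=
  a0 ∈ Set.Icc (0:ℝ) 1 ∧ a1 ∈ Set.Icc (0:ℝ) 1 ∧ 0 ≤ d0 ∧ 0 ≤ d1 ∧
    (1 - γ * a0) * d0 - γ * a1 * d1 = (1 - γ) * δ ∧ d0 + d1 = 1 ∧
    2 * d0 * |a0 - p0| + 2 * d1 * |a1 - p1| ≤ b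

/-- Objective of problem P2. -/
noncomputable def objP2 (a0 a1 d0 d1 : ℝ) : ℝ := d0 * binEnt a0 + d1 * binEnt a1

theorem binEnt_eq_binEntropy : binEnt = Real.binEntropy := by
  funext a
  rw [binEnt, Real.binEntropy_eq_negMulLog_add_negMulLog_one_sub, Real.negMulLog, Real.negMulLog]
  ring

theorem average_id_eq_integral_div (μ : Measure ℝ) : ⨍ a, a ∂μ = (∫ a, a ∂μ) / (μ univ).toReal := by
  rw [average_eq, smul_eq_mul, div_eq_inv_mul]
  rfl

section Barycenter

variable {μ : Measure ℝ} [IsFiniteMeasure μ]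

theorem integrable_of_continuous_of_measure_compl_Icc_eq_zero
    (hμ : μ (Icc (0:ℝ) 1)ᶜ = 0) {f : ℝ → ℝ} (hf : Continuous f) : Integrable f μ := by
  have hon : IntegrableOn f (Icc 0 1) μ := hf.continuousOn.integrableOn_compact isCompact_Icc
  rwa [IntegrableOn, Measure.restrict_eq_self_of_ae_mem (by rwa [← mem_ae_iff] at hμ)] at hon

theorem barycenter_mem_Icc [NeZero μ] (hμ : μ (Icc (0:ℝ) 1)ᶜ = 0) :
    (∫ a, a ∂μ) / (μ univ).toReal ∈ Icc (0:ℝ) 1 := by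
  rw [← average_id_eq_integral_div]
  exact (convex_Icc 0 1).average_mem isClosed_Icc (by rwa [← mem_ae_iff] at hμ)
    (integrable_of_continuous_of_measure_compl_Icc_eq_zero hμ continuous_id)

theorem integral_binEnt_le [NeZero μ] (hμ : μ (Icc (0:ℝ) 1)ᶜ = 0) :
    ∫ a, binEnt a ∂μ ≤ (μ univ).toReal * binEnt ((∫ a, a ∂μ) / (μ univ).toReal) := by
  have h := Real.strictConcave_binEntropy.concaveOn.le_map_average
    Real.binEntropy_continuous.continuousOn isClosed_Icc
    (f := fun a => a) (μ := μ) (by rwa [← mem_ae_iff] at hμ)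
    (integrable_of_continuous_of_measure_compl_Icc_eq_zero hμ continuous_id)
    (integrable_of_continuous_of_measure_compl_Icc_eq_zero hμ Real.binEntropy_continuous)
  rw [binEnt_eq_binEntropy, ← average_id_eq_integral_div, ← measureReal_def, ← smul_eq_mul,
    ← measure_smul_average]
  exact smul_le_smul_of_nonneg_left h measureReal_nonneg

theorem mul_abs_barycenter_sub_le [NeZero μ] (hμ : μ (Icc (0:ℝ) 1)ᶜ = 0) (p : ℝ) :
    (μ univ).toReal * |(∫ a, a ∂μ) / (μ univ).toReal - p| ≤ ∫ a, |a - p| ∂μ := by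
  have hpos : 0 < (μ univ).toReal := measureReal_univ_pos
  have hint : Integrable (fun a : ℝ => a) μ :=
    integrable_of_continuous_of_measure_compl_Icc_eq_zero hμ continuous_id
  calc (μ univ).toReal * |(∫ a, a ∂μ) / (μ univ).toReal - p|
      = |(μ univ).toReal * ((∫ a, a ∂μ) / (μ univ).toReal - p)| := by
        rw [abs_mul, abs_of_pos hpos]
    _ = |∫ a, (a - p) ∂μ| := by
        rw [integral_sub hint (integrable_const p), integral_const, smul_eq_mul, measureReal_def,
          mul_sub, mul_div_cancel₀ _ hpos.ne']
    _ ≤ ∫ a, |a - p| ∂μ := abs_integral_le_integral_abs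

end Barycenter

theorem barycenter_feasible_and_dominates
    (p0 p1 γ δ b : ℝ)
    (hp0 : p0 ∈ Set.Ioo (0:ℝ) 1) (hp1 : p1 ∈ Set.Ioo (0:ℝ) 1)
    (hγ : γ ∈ Set.Ico (0:ℝ) 1) (hδ : δ ∈ Set.Ioo (0:ℝ) 1) (hb : 0 ≤ b)
    (μ0 μ1 : Measure ℝ) (hfeas : FeasP1 p0 p1 γ δ b μ0 μ1)
    (d0 d1 : ℝ) (hd0 : d0 = (μ0 Set.univ).toReal) (hd1 : d1 = (μ1 Set.univ).toReal)
    (hd0pos : 0 < d0) (hd1pos : 0 < d1)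
    (a0 a1 : ℝ) (ha0 : a0 = (∫ a, a ∂μ0) / d0) (ha1 : a1 = (∫ a, a ∂μ1) / d1) :
    FeasP2 p0 p1 γ δ b a0 a1 d0 d1 ∧
      (∫ a, binEnt a ∂μ0) + (∫ a, binEnt a ∂μ1) ≤ objP2 a0 a1 d0 d1 := by
  obtain ⟨_, _, hs0, hs1, hbal, hmass, hbud⟩ := hfeas
  have : NeZero μ0 := ⟨by rintro rfl; simp [hd0] at hd0pos⟩
  have : NeZero μ1 := ⟨by rintro rfl; simp [hd1] at hd1pos⟩
  have hint : Integrable (fun a : ℝ => a) μ0 :=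
    integrable_of_continuous_of_measure_compl_Icc_eq_zero hs0 continuous_id
  have hm0 : a0 * d0 = ∫ a, a ∂μ0 := by rw [ha0, div_mul_cancel₀ _ hd0pos.ne']
  have hm1 : a1 * d1 = ∫ a, a ∂μ1 := by rw [ha1, div_mul_cancel₀ _ hd1pos.ne']
  rw [integral_sub (integrable_const 1) (hint.const_mul γ), integral_const, integral_const_mul,
    measureReal_def, smul_eq_mul, mul_one, ← hd0, ← hm0, ← hm1] at hbal
  rw [← hd0, ← hd1] at hmass
  have hb0 := mul_abs_barycenter_sub_le hs0 p0
  have hb1 := mul_abs_barycenter_sub_le hs1 p1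
  have hH0 := integral_binEnt_le hs0
  have hH1 := integral_binEnt_le hs1
  have hI0 := barycenter_mem_Icc hs0
  have hI1 := barycenter_mem_Icc hs1
  rw [← hd0, ← ha0] at hb0 hH0 hI0
  rw [← hd1, ← ha1] at hb1 hH1 hI1
  exact ⟨⟨hI0, hI1, hd0pos.le, hd1pos.le, by linarith, hmass, by linarith⟩,
    add_le_add hH0 hH1⟩
end

section
/- Let p0, p1 ∈ (0,1), γ ∈ [0,1), δ ∈ (0,1), b ≥ 0. The supremum of the objective of problem P1 over all feasible measure pairs equals the maximum of the objective of problem P2 over all feasible tuples, and the maximum in P2 is attained; moreover, the P1 supremum is attained by a pair of point masses (d0·δ_{a0}, d1·δ_{a1}) for some P2-optimal tuple (a0, a1, d0, d1) (i.e., a deterministic policy is optimal). -/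
open MeasureTheory Set

theorem continuous_binEnt : Continuous binEnt :=
  binEnt_eq_binEntropy ▸ Real.binEntropy_continuous

/-- A continuous function is integrable against a finite measure carried by `[0, 1]`. -/
theorem Continuous.integrable_of_compl_Icc_null {f : ℝ → ℝ} (hf : Continuous f)
    (μ : Measure ℝ) [IsFiniteMeasure μ] (hμ : μ (Set.Icc (0:ℝ) 1)ᶜ = 0) : Integrable f μ := by
  rw [← Measure.restrict_eq_self_of_ae_mem (mem_ae_iff.mpr hμ)]
  exact hf.continuousOn.integrableOn_compact isCompact_Icc

/-- Replacing a finite measure on `[0, 1]` by a point mass at its barycenter preserves the mass and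
the mean, does not increase the mean distance to `p`, and does not decrease the entropy. -/
theorem exists_barycenter (p : ℝ) (μ : Measure ℝ) [IsFiniteMeasure μ]
    (hμ : μ (Set.Icc (0:ℝ) 1)ᶜ = 0) :
    ∃ a ∈ Set.Icc (0:ℝ) 1, ∫ x, x ∂μ = μ.real Set.univ * a ∧
      μ.real Set.univ * |a - p| ≤ ∫ x, |x - p| ∂μ ∧
      ∫ x, binEnt x ∂μ ≤ μ.real Set.univ * binEnt a := by
  rcases eq_zero_or_neZero μ with rfl | hne
  · exact ⟨0, by simp, by simp⟩
  have hae : ∀ᵐ x ∂μ, x ∈ Set.Icc (0:ℝ) 1 := mem_ae_iff.mpr hμ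
  have hid : Integrable (fun x : ℝ => x) μ := continuous_id.integrable_of_compl_Icc_null μ hμ
  have hent : Integrable binEnt μ := continuous_binEnt.integrable_of_compl_Icc_null μ hμ
  have hd : 0 < μ.real Set.univ := measureReal_univ_pos
  have hmul (f : ℝ → ℝ) : μ.real Set.univ * ⨍ x, f x ∂μ = ∫ x, f x ∂μ := by
    rw [average_eq, smul_eq_mul, mul_inv_cancel_left₀ hd.ne']
  have hconc : ConcaveOn ℝ (Set.Icc (0:ℝ) 1) binEnt :=
    binEnt_eq_binEntropy ▸ Real.strictConcave_binEntropy.concaveOn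
  refine ⟨⨍ x, x ∂μ, (convex_Icc 0 1).average_mem isClosed_Icc hae hid, (hmul _).symm, ?_, ?_⟩
  · rw [← abs_of_pos hd, ← abs_mul, mul_sub, hmul]
    have : ∫ x, x ∂μ - μ.real Set.univ * p = ∫ x, (x - p) ∂μ := by
      rw [integral_sub hid (integrable_const p), integral_const, smul_eq_mul]
    rw [this]
    exact abs_integral_le_integral_abs
  · rw [← hmul]
    exact mul_le_mul_of_nonneg_left
      (hconc.le_map_average continuous_binEnt.continuousOn isClosed_Icc hae hid hent) hd.le

theorem FeasP1.exists_feasP2 {p0 p1 γ δ b : ℝ} {μ0 μ1 : Measure ℝ}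
    (h : FeasP1 p0 p1 γ δ b μ0 μ1) :
    ∃ a0 a1 d0 d1 : ℝ, FeasP2 p0 p1 γ δ b a0 a1 d0 d1 ∧
      (∫ a, binEnt a ∂μ0) + (∫ a, binEnt a ∂μ1) ≤ objP2 a0 a1 d0 d1 := by
  obtain ⟨_, _, h0, h1, hflow, hmass, hcost⟩ := h
  obtain ⟨a0, ha0, hm0, hc0, he0⟩ := exists_barycenter p0 μ0 h0
  obtain ⟨a1, ha1, hm1, hc1, he1⟩ := exists_barycenter p1 μ1 h1
  refine ⟨a0, a1, μ0.real Set.univ, μ1.real Set.univ,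
    ⟨ha0, ha1, measureReal_nonneg, measureReal_nonneg, ?_, hmass, by linarith⟩, add_le_add he0 he1⟩
  have hid : Integrable (fun x : ℝ => x) μ0 := continuous_id.integrable_of_compl_Icc_null μ0 h0
  rw [integral_sub (integrable_const 1) (hid.const_mul γ), integral_const, integral_const_mul,
    smul_eq_mul, hm0, hm1] at hflow
  linarith

theorem FeasP2.feasP1_dirac {p0 p1 γ δ b a0 a1 d0 d1 : ℝ}
    (h : FeasP2 p0 p1 γ δ b a0 a1 d0 d1) :
    FeasP1 p0 p1 γ δ b
      ((ENNReal.ofReal d0) • Measure.dirac a0) ((ENNReal.ofReal d1) • Measure.dirac a1) := by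
  obtain ⟨ha0, ha1, hd0, hd1, hflow, hmass, hcost⟩ := h
  refine ⟨Measure.smul_finite _ ENNReal.ofReal_ne_top, Measure.smul_finite _ ENNReal.ofReal_ne_top,
    ?_, ?_, ?_, ?_, ?_⟩
  · simp [ha0.1, ha0.2]
  · simp [ha1.1, ha1.2]
  · simp only [integral_smul_measure, integral_dirac, ENNReal.toReal_ofReal hd0,
      ENNReal.toReal_ofReal hd1, smul_eq_mul]
    linarith
  · simpa [hd0, hd1] using hmass
  · simp only [integral_smul_measure, integral_dirac, ENNReal.toReal_ofReal hd0,
      ENNReal.toReal_ofReal hd1, smul_eq_mul]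
    linarith

theorem exists_feasP2 {p0 p1 γ δ b : ℝ}
    (hp0 : p0 ∈ Set.Ioo (0:ℝ) 1) (hp1 : p1 ∈ Set.Ioo (0:ℝ) 1)
    (hγ : γ ∈ Set.Ico (0:ℝ) 1) (hδ : δ ∈ Set.Ioo (0:ℝ) 1) (hb : 0 ≤ b) :
    ∃ d0 d1 : ℝ, FeasP2 p0 p1 γ δ b p0 p1 d0 d1 := by
  obtain ⟨⟨h1, h2⟩, ⟨h3, h4⟩, ⟨h5, h6⟩, h7, h8⟩ := hp0, hp1, hγ, hδ
  have hg0 : γ * p0 ≤ γ := mul_le_of_le_one_right h5 h2.le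
  have hg1 : 0 ≤ γ * p1 := mul_nonneg h5 h3.le
  have hD : 0 < 1 - γ * p0 + γ * p1 := by linarith
  have hδ0 : 0 ≤ (1 - γ) * δ := mul_nonneg (by linarith) h7.le
  have hδ1 : (1 - γ) * δ ≤ 1 - γ := mul_le_of_le_one_right (by linarith) h8.le
  set d := ((1 - γ) * δ + γ * p1) / (1 - γ * p0 + γ * p1) with hd
  have hdD : d * (1 - γ * p0 + γ * p1) = (1 - γ) * δ + γ * p1 := div_mul_cancel₀ _ hD.ne'
  refine ⟨d, 1 - d, ⟨h1.le, h2.le⟩, ⟨h3.le, h4.le⟩, div_nonneg (by linarith) hD.le,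
    sub_nonneg.mpr ((div_le_one hD).mpr (by linarith)), by linarith, by ring, by simpa using hb⟩

theorem isCompact_feasP2 (p0 p1 γ δ b : ℝ) :
    IsCompact {x : ℝ × ℝ × ℝ × ℝ | FeasP2 p0 p1 γ δ b x.1 x.2.1 x.2.2.1 x.2.2.2} := by
  have hK : IsCompact (Set.Icc (0:ℝ) 1 ×ˢ Set.Icc (0:ℝ) 1 ×ˢ Set.Icc (0:ℝ) 1 ×ˢ Set.Icc (0:ℝ) 1) :=
    isCompact_Icc.prod (isCompact_Icc.prod (isCompact_Icc.prod isCompact_Icc))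
  refine hK.of_isClosed_subset ?_ ?_
  · simp only [FeasP2, Set.mem_Icc, Set.ofPred_and]
    repeat' apply IsClosed.inter
    all_goals first
      | exact isClosed_le (by fun_prop) (by fun_prop)
      | exact isClosed_eq (by fun_prop) (by fun_prop)
  · rintro ⟨a0, a1, d0, d1⟩ ⟨ha0, ha1, hd0, hd1, -, hmass, -⟩
    dsimp only at *
    exact ⟨ha0, ha1, ⟨hd0, by linarith⟩, hd1, by linarith⟩

/-- Theorem 1: the P1 supremum equals the attained P2 maximum, and the P1 supremum is
attained by a pair of scaled Dirac point masses coming from a P2-optimal tuple. -/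
theorem P1_sup_eq_P2_max
    (p0 p1 γ δ b : ℝ)
    (hp0 : p0 ∈ Set.Ioo (0:ℝ) 1) (hp1 : p1 ∈ Set.Ioo (0:ℝ) 1)
    (hγ : γ ∈ Set.Ico (0:ℝ) 1) (hδ : δ ∈ Set.Ioo (0:ℝ) 1) (hb : 0 ≤ b) :
    ∃ a0 a1 d0 d1 : ℝ,
      FeasP2 p0 p1 γ δ b a0 a1 d0 d1 ∧
      (∀ a0' a1' d0' d1' : ℝ, FeasP2 p0 p1 γ δ b a0' a1' d0' d1' →
        objP2 a0' a1' d0' d1' ≤ objP2 a0 a1 d0 d1) ∧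
      FeasP1 p0 p1 γ δ b
        ((ENNReal.ofReal d0) • Measure.dirac a0) ((ENNReal.ofReal d1) • Measure.dirac a1) ∧
      (∫ a, binEnt a ∂((ENNReal.ofReal d0) • Measure.dirac a0)) +
        (∫ a, binEnt a ∂((ENNReal.ofReal d1) • Measure.dirac a1)) = objP2 a0 a1 d0 d1 ∧
      (∀ μ0 μ1 : Measure ℝ, FeasP1 p0 p1 γ δ b μ0 μ1 →
        (∫ a, binEnt a ∂μ0) + (∫ a, binEnt a ∂μ1) ≤ objP2 a0 a1 d0 d1) := by
  obtain ⟨d0, d1, hne⟩ := exists_feasP2 hp0 hp1 hγ hδ hb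
  have hcont : Continuous fun x : ℝ × ℝ × ℝ × ℝ => objP2 x.1 x.2.1 x.2.2.1 x.2.2.2 := by
    have := continuous_binEnt
    unfold objP2
    fun_prop
  obtain ⟨⟨a0, a1, d0, d1⟩, hx, hmax⟩ :=
    (isCompact_feasP2 p0 p1 γ δ b).exists_isMaxOn ⟨(p0, p1, d0, d1), hne⟩ hcont.continuousOn
  have hopt (a0' a1' d0' d1' : ℝ) (h : FeasP2 p0 p1 γ δ b a0' a1' d0' d1') :
      objP2 a0' a1' d0' d1' ≤ objP2 a0 a1 d0 d1 :=
    hmax (show (a0', a1', d0', d1') ∈ _ from h)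
  refine ⟨a0, a1, d0, d1, hx, hopt, FeasP2.feasP1_dirac hx, ?_, fun μ0 μ1 h => ?_⟩
  · simp only [integral_smul_measure, integral_dirac, ENNReal.toReal_ofReal hx.2.2.1,
      ENNReal.toReal_ofReal hx.2.2.2.1, smul_eq_mul, objP2]
  · obtain ⟨a0', a1', d0', d1', h', hle⟩ := h.exists_feasP2
    exact hle.trans (hopt _ _ _ _ h')
end

section
/- (Theorem 2, highly-constrained regime, case p1 ≥ p0.) Let p0, p1 ∈ (0,1) with 1/2 ≤ p0 ≤ p1, γ ∈ [0,1), δ ∈ (0,1). Let d0^γ = (1−γ)δ, b_l = 2·max{(1−γp0−d0^γ)(p1−p0), (d0^γ+γp1)(p0−p1)}, and η1⁻(b) = ((b/2)(1−γp0) − p1(1−γp0−d0^γ)) / (−(1−γp0−d0^γ) − γ·b/2). If 0 ≤ b < b_l, then the tuple (a0, a1, d0, d1) with a0 = p0, a1 = η1⁻(b), d0 = D0(a0, a1), d1 = D1(a0, a1) is feasible for problem P2 and attains the maximum of P2: every feasible tuple has objective value at most F(a0, a1, d0, d1). -/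
/-- Discounted visitation frequency of state 0 induced by the deterministic policy `(a0, a1)`. -/
noncomputable def D0 (γ δ a0 a1 : ℝ) : ℝ := ((1 - γ) * δ + γ * a1) / (1 - γ * a0 + γ * a1)

/-- Discounted visitation frequency of state 1. -/
noncomputable def D1 (γ δ a0 a1 : ℝ) : ℝ := 1 - D0 γ δ a0 a1

/-- Gibbs' inequality: the binary entropy is bounded by any cross entropy. -/
theorem binEnt_le_crossEntropy {a q : ℝ} (ha0 : 0 ≤ a) (ha1 : a ≤ 1) (hq0 : 0 < q) (hq1 : q < 1) :
    binEnt a ≤ -a * Real.log q - (1 - a) * Real.log (1 - q) := by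
  have key : ∀ x y : ℝ, 0 ≤ x → 0 < y → x * (Real.log y - Real.log x) ≤ y - x := by
    intro x y hx hy
    rcases hx.eq_or_lt with rfl | hx
    · simpa using hy.le
    · rw [← Real.log_div hy.ne' hx.ne']
      have h := mul_le_mul_of_nonneg_left (Real.log_le_sub_one_of_pos (div_pos hy hx)) hx.le
      have hxy : x * (y / x - 1) = y - x := by field_simp
      exact h.trans_eq hxy
  have h1 := key a q ha0 hq0
  have h2 := key (1 - a) (1 - q) (by linarith) (by linarith)
  unfold binEnt
  linarith

/-- The linear program behind the first-order optimality condition: among perturbations `(u, v)` of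
total size at most `β`, the value is largest at `(0, -β)`. Here `w` is the induced change of the
visitation frequency and `E` its marginal value. -/
theorem linearized_gain_nonpos {u v w β E g0 g1 r γ : ℝ} (hγ0 : 0 ≤ γ) (hγ1 : γ ≤ 1)
    (hr0 : 0 ≤ r) (hr : r ≤ 1 / 2) (hw : (1 + γ * r) * w = γ * (u + v + β))
    (huv : |u| + |v| ≤ β) (hE : E ≤ -g1 * r) (hg0 : g0 ≤ 0) (hg : g1 ≤ g0) :
    w * E + u * g0 + (v + β) * g1 ≤ 0 := by
  have hu := abs_le.mp (le_refl |u|)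
  have hv := abs_le.mp (le_refl |v|)
  have hm : 0 ≤ u + v + β := by linarith
  have hγr : 0 ≤ γ * r := mul_nonneg hγ0 hr0
  have hw0 : 0 ≤ w := by
    by_contra! hneg
    nlinarith [mul_nonneg hγ0 hm]
  have hw1 : w ≤ u + v + β := by
    nlinarith [mul_nonneg hγr hw0, mul_nonneg (sub_nonneg.mpr hγ1) hm]
  have hwr : w * r ≤ (u + v + β) / 2 := by
    nlinarith [mul_nonneg hw0 (sub_nonneg.mpr hr)]
  have hwE : w * E ≤ -g1 * ((u + v + β) / 2) := by
    calc w * E ≤ w * (-g1 * r) := mul_le_mul_of_nonneg_left hE hw0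
      _ = -g1 * (w * r) := by ring
      _ ≤ _ := mul_le_mul_of_nonneg_left hwr (by linarith)
  rcases le_total 0 u with h | h
  · rw [abs_of_nonneg h] at huv
    have h1 : 0 ≤ v + β - u := by linarith
    nlinarith [mul_nonneg h1 (neg_nonneg.mpr (hg.trans hg0)), mul_nonneg h (neg_nonneg.mpr hg0)]
  · nlinarith [mul_nonneg hm (neg_nonneg.mpr (hg.trans hg0)),
      mul_nonneg (neg_nonneg.mpr h) (sub_nonneg.mpr hg)]

/-- Theorem 2, highly-constrained regime, case `1/2 ≤ p0 ≤ p1` (`0 ≤ b < b_l`):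
the optimal policy is `a0 = p0`, `a1 = η1⁻(b)`. -/
theorem thm2_highly_constrained_p1_ge_p0
    (p0 p1 γ δ b : ℝ)
    (hp0 : p0 ∈ Set.Ioo (0:ℝ) 1) (hp1 : p1 ∈ Set.Ioo (0:ℝ) 1)
    (hp0half : 1/2 ≤ p0) (hp0p1 : p0 ≤ p1)
    (hγ : γ ∈ Set.Ico (0:ℝ) 1) (hδ : δ ∈ Set.Ioo (0:ℝ) 1)
    (hb0 : 0 ≤ b)
    (hbl : b < 2 * max ((1 - γ * p0 - (1 - γ) * δ) * (p1 - p0))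
        (((1 - γ) * δ + γ * p1) * (p0 - p1)))
    (a1 : ℝ)
    (ha1 : a1 = ((b / 2) * (1 - γ * p0) - p1 * (1 - γ * p0 - (1 - γ) * δ)) /
        (-(1 - γ * p0 - (1 - γ) * δ) - γ * (b / 2))) :
    FeasP2 p0 p1 γ δ b p0 a1 (D0 γ δ p0 a1) (D1 γ δ p0 a1) ∧
      ∀ a0' a1' d0' d1' : ℝ, FeasP2 p0 p1 γ δ b a0' a1' d0' d1' →
        objP2 a0' a1' d0' d1' ≤ objP2 p0 a1 (D0 γ δ p0 a1) (D1 γ δ p0 a1) := by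
  obtain ⟨hp00, hp01⟩ := hp0
  obtain ⟨hp10, hp11⟩ := hp1
  obtain ⟨hγ0, hγ1⟩ := hγ
  obtain ⟨hδ0, hδ1⟩ := hδ
  set c := (1 - γ) * δ with hc
  set k := 1 - γ * p0 - c with hk
  have hc0 : 0 < c := mul_pos (by linarith) hδ0
  have hk0 : 0 < k := by nlinarith
  have hγp : 0 ≤ γ * p1 := mul_nonneg hγ0 hp10.le
  have hbk : b / 2 < k * (p1 - p0) := by
    rcases lt_max_iff.mp ((div_lt_iff₀' two_pos).mpr hbl) with h | h
    · exact h
    · nlinarith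
  have hden : 0 < k + γ * (b / 2) := by positivity
  have ha1' : a1 * (k + γ * (b / 2)) = p1 * k - b / 2 * (1 - γ * p0) := by
    rw [ha1, div_mul_eq_mul_div, div_eq_iff (by linarith)]
    ring
  have hpa : p0 < a1 := by
    by_contra! h
    nlinarith [mul_le_mul_of_nonneg_right h hden.le]
  have hq0 : 0 < 1 - γ * p0 := by linarith
  have hap : a1 ≤ p1 := by
    by_contra! h
    nlinarith [mul_lt_mul_of_pos_right h hden, mul_nonneg hb0 hq0.le, mul_nonneg hb0 hγp]
  have ha10 : 0 < a1 := hp00.trans hpa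
  have ha11 : a1 < 1 := hap.trans_lt hp11
  have hq : 0 < 1 - γ * p0 + γ * a1 := by positivity
  have hd0 : D0 γ δ p0 a1 * (1 - γ * p0 + γ * a1) = c + γ * a1 := div_mul_cancel₀ _ hq.ne'
  have hd00 : 0 ≤ D0 γ δ p0 a1 := div_nonneg (by positivity) hq.le
  have hd1 : D1 γ δ p0 a1 = 1 - D0 γ δ p0 a1 := rfl
  rw [hd1]
  generalize D0 γ δ p0 a1 = d at hd0 hd00 ⊢
  have hd1q : (1 - d) * (1 - γ * p0 + γ * a1) = k := by linarith
  have hd10 : 0 ≤ 1 - d := by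
    by_contra! h
    nlinarith [mul_pos_of_neg_of_neg h (neg_neg_of_pos hq)]
  have hbud : (1 - d) * (p1 - a1) = b / 2 := by
    apply mul_right_cancel₀ hq.ne'
    linear_combination (p1 - a1) * hd1q - ha1'
  refine ⟨⟨⟨hp00.le, hp01.le⟩, ⟨ha10.le, ha11.le⟩, hd00, hd10, by linarith, by ring, ?_⟩, ?_⟩
  · rw [sub_self, abs_zero, abs_of_nonpos (by linarith)]
    linarith
  rintro x y e f ⟨⟨hx0, hx1⟩, ⟨hy0, hy1⟩, he, hf, hflow, hsum, hbudget⟩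
  have hmono0 : Real.log (1 - p0) - Real.log p0 ≤ 0 :=
    sub_nonpos.mpr (Real.log_le_log (by linarith) (by linarith))
  have hmono1 : Real.log (1 - a1) - Real.log a1 ≤ Real.log (1 - p0) - Real.log p0 :=
    sub_le_sub (Real.log_le_log (by linarith) (by linarith)) (Real.log_le_log hp00 hpa.le)
  have hGx := mul_le_mul_of_nonneg_left (binEnt_le_crossEntropy hx0 hx1 hp00 hp01) he
  have hGy := mul_le_mul_of_nonneg_left (binEnt_le_crossEntropy hy0 hy1 ha10 ha11) hf
  have hGp := binEnt_le_crossEntropy hp00.le hp01.le ha10 ha11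
  unfold objP2
  simp only [binEnt] at hGx hGy hGp ⊢
  generalize Real.log p0 = L0 at *
  generalize Real.log (1 - p0) = M0 at *
  generalize Real.log a1 = L1 at *
  generalize Real.log (1 - a1) = M1 at *
  have hf' : f = 1 - e := by linarith
  have hlin := linearized_gain_nonpos (u := e * (x - p0)) (v := f * (y - p1)) (w := e - d)
    (β := b / 2) (E := (-p0 * L0 - (1 - p0) * M0) - (-p1 * L1 - (1 - p1) * M1))
    (r := p1 - p0) hγ0 hγ1.le (by linarith) (by linarith)
    (by subst hf'; linear_combination hflow - hd0 + γ * hbud)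
    (by rw [abs_mul, abs_mul, abs_of_nonneg he, abs_of_nonneg hf]; linarith)
    (by linarith) hmono0 hmono1
  have hstar : (1 - d) * (-a1 * L1 - (1 - a1) * M1)
      = (1 - d) * (-p1 * L1 - (1 - p1) * M1) - b / 2 * (M1 - L1) := by
    linear_combination (L1 - M1) * hbud
  subst hf'
  linarith
end

section
/- (Theorem 2, highly-constrained regime, case p0 > p1.) Let p0, p1 ∈ (0,1) with 1/2 ≤ p1 < p0, γ ∈ [0,1), δ ∈ (0,1). Let d0^γ = (1−γ)δ, b_l = 2·max{(1−γp0−d0^γ)(p1−p0), (d0^γ+γp1)(p0−p1)}, and η0⁻(b) = ((b/2)(1+γp1) − p0(d0^γ+γp1)) / (−(γp1+d0^γ) + γ·b/2). If 0 ≤ b < b_l, then the tuple (a0, a1, d0, d1) with a0 = η0⁻(b), a1 = p1, d0 = D0(a0, a1), d1 = D1(a0, a1) is feasible for problem P2 and attains the maximum of P2: every feasible tuple has objective value at most F(a0, a1, d0, d1). -/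
/-- The lower linear bound `a * log t + (a - t)` for `a * log a`. -/
theorem mul_log_add_sub_le {a t : ℝ} (ha : 0 ≤ a) (ht : 0 < t) :
    a * Real.log t + (a - t) ≤ a * Real.log a := by
  rcases ha.eq_or_lt with rfl | ha
  · simp [ht.le]
  · have h := Real.log_le_sub_one_of_pos (div_pos ht ha)
    rw [Real.log_div ht.ne' ha.ne'] at h
    have h2 := mul_le_mul_of_nonneg_left h ha.le
    have h3 : a * (t / a - 1) = t - a := by field_simp
    linarith

/-- The binary entropy lies below its tangent lines. -/
theorem binEnt_le_tangent {a t : ℝ} (ha : a ∈ Set.Icc (0:ℝ) 1) (ht : t ∈ Set.Ioo (0:ℝ) 1) :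
    binEnt a ≤ binEnt t - (Real.log t - Real.log (1 - t)) * (a - t) := by
  have h1 := mul_log_add_sub_le ha.1 ht.1
  have h2 := mul_log_add_sub_le (sub_nonneg.2 ha.2) (sub_pos.2 ht.2)
  unfold binEnt
  linarith

/-- Theorem 2, highly-constrained regime, case `1/2 ≤ p1 < p0` (`0 ≤ b < b_l`):
the optimal policy is `a0 = η0⁻(b)`, `a1 = p1`. -/
theorem thm2_highly_constrained_p0_gt_p1
    (p0 p1 γ δ b : ℝ)
    (hp0 : p0 ∈ Set.Ioo (0:ℝ) 1) (hp1 : p1 ∈ Set.Ioo (0:ℝ) 1)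
    (hp1half : 1/2 ≤ p1) (hp1p0 : p1 < p0)
    (hγ : γ ∈ Set.Ico (0:ℝ) 1) (hδ : δ ∈ Set.Ioo (0:ℝ) 1)
    (hb0 : 0 ≤ b)
    (hbl : b < 2 * max ((1 - γ * p0 - (1 - γ) * δ) * (p1 - p0))
        (((1 - γ) * δ + γ * p1) * (p0 - p1)))
    (a0 : ℝ)
    (ha0 : a0 = ((b / 2) * (1 + γ * p1) - p0 * ((1 - γ) * δ + γ * p1)) /
        (-(γ * p1 + (1 - γ) * δ) + γ * (b / 2))) :
    FeasP2 p0 p1 γ δ b a0 p1 (D0 γ δ a0 p1) (D1 γ δ a0 p1) ∧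
      ∀ a0' a1' d0' d1' : ℝ, FeasP2 p0 p1 γ δ b a0' a1' d0' d1' →
        objP2 a0' a1' d0' d1' ≤ objP2 a0 p1 (D0 γ δ a0 p1) (D1 γ δ a0 p1) := by
  obtain ⟨hp00, hp01⟩ := hp0
  obtain ⟨hγ0, hγ1⟩ := hγ
  obtain ⟨hδ0, hδ1⟩ := hδ
  have hc0 : 0 < (1 - γ) * δ := mul_pos (by linarith) hδ0
  have hc1 : (1 - γ) * δ < 1 - γ := by nlinarith
  set c := (1 - γ) * δ with hc
  obtain ⟨B, rfl⟩ : ∃ B, b = 2 * B := ⟨b / 2, by ring⟩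
  rw [show 2 * B / 2 = B by ring] at ha0
  have hB : 0 ≤ B := by linarith
  have hA : 0 < c + γ * p1 := by nlinarith [hp1.1]
  have hE : 0 < 1 + γ * p1 - γ * p0 := by nlinarith [hp1.1]
  have hBA : B < (c + γ * p1) * (p0 - p1) := by
    have h1 : (1 - γ * p0 - c) * (p1 - p0) ≤ (c + γ * p1) * (p0 - p1) := by
      have : 0 ≤ 1 - γ * p0 - c := by nlinarith
      nlinarith [mul_pos hA (sub_pos.2 hp1p0)]
    rw [max_eq_right h1] at hbl
    linarith
  have hden : 0 < c + γ * p1 - γ * B := by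
    have : B < c + γ * p1 := by nlinarith [hp1.1]
    nlinarith
  have ha0' : a0 * (c + γ * p1 - γ * B) = p0 * (c + γ * p1) - B * (1 + γ * p1) := by
    rw [ha0, div_mul_eq_mul_div, div_eq_iff (by linarith)]
    ring
  have hle : a0 ≤ p0 := by
    refine le_of_mul_le_mul_right ?_ hden
    nlinarith [mul_nonneg hB hE.le]
  have hge : p1 ≤ a0 := by
    refine le_of_mul_le_mul_right ?_ hden
    nlinarith
  have hN : 0 < 1 - γ * a0 + γ * p1 := by nlinarith
  have hd0 : D0 γ δ a0 p1 * (1 + γ * p1 - γ * p0) = c + γ * p1 - γ * B := by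
    rw [D0, ← hc, div_mul_eq_mul_div, div_eq_iff hN.ne']
    linear_combination γ * ha0'
  have hdN : D0 γ δ a0 p1 * (1 - γ * a0 + γ * p1) = c + γ * p1 := by
    rw [D0, div_mul_cancel₀ _ hN.ne']
  have hD1 : D1 γ δ a0 p1 = 1 - D0 γ δ a0 p1 := rfl
  rw [hD1]
  generalize D0 γ δ a0 p1 = d at *
  have hdpos : 0 < d := pos_of_mul_pos_left (hd0 ▸ hden) hE.le
  have hd1 : d ≤ 1 := by
    refine le_of_mul_le_mul_right ?_ hN
    nlinarith
  have hdB : d * (p0 - a0) = B := by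
    refine mul_right_cancel₀ hE.ne' ?_
    linear_combination (p0 - a0) * hd0 - ha0'
  have ha01 : a0 ∈ Set.Ioo (0:ℝ) 1 := ⟨hp1.1.trans_le hge, hle.trans_lt hp01⟩
  refine ⟨⟨⟨ha01.1.le, ha01.2.le⟩, ⟨hp1.1.le, hp1.2.le⟩, hdpos.le, by linarith,
    by linear_combination hdN, by ring, ?_⟩, ?_⟩
  · rw [abs_of_nonpos (by linarith), sub_self, abs_zero]
    linarith
  rintro x0 x1 e0 e1 ⟨hx0, hx1, he0, he1, hflow, hsum, hcost⟩
  have hT0 := mul_le_mul_of_nonneg_left (binEnt_le_tangent hx0 ha01) he0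
  have hT1 := mul_le_mul_of_nonneg_left (binEnt_le_tangent hx1 hp1) he1
  have hT := binEnt_le_tangent ⟨ha01.1.le, ha01.2.le⟩ hp1
  have hl1 : Real.log (1 - p1) ≤ Real.log p1 :=
    Real.log_le_log (by linarith [hp1.2]) (by linarith)
  have hl2 : Real.log p1 ≤ Real.log a0 := Real.log_le_log hp1.1 hge
  have hl3 : Real.log (1 - a0) ≤ Real.log (1 - p1) :=
    Real.log_le_log (by linarith [ha01.2]) (by linarith)
  set h0 := Real.log a0 - Real.log (1 - a0)
  set h1 := Real.log p1 - Real.log (1 - p1)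
  have hh1 : 0 ≤ h1 := sub_nonneg.2 hl1
  have hh : h1 ≤ h0 := by linarith
  unfold objP2
  generalize binEnt a0 = H0 at *
  generalize binEnt p1 = H1 at *
  obtain ⟨u, hu⟩ : ∃ u, u = e0 * (p0 - x0) := ⟨_, rfl⟩
  obtain ⟨v, hv⟩ : ∃ v, v = e1 * (p1 - x1) := ⟨_, rfl⟩
  have hu1 : u ≤ e0 * |x0 - p0| := by
    rw [hu, abs_sub_comm]; exact mul_le_mul_of_nonneg_left (le_abs_self _) he0
  have hv1 : v ≤ e1 * |x1 - p1| := by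
    rw [hv, abs_sub_comm]; exact mul_le_mul_of_nonneg_left (le_abs_self _) he1
  have hv2 : 0 ≤ e1 * |x1 - p1| := mul_nonneg he1 (abs_nonneg _)
  have huv : u + v ≤ B := by linarith
  have huB : u ≤ B := by linarith
  have hG : 0 ≤ H1 - H0 + h0 * (p0 - a0) := by
    linarith [mul_nonneg hh1 (sub_nonneg.2 hge), mul_nonneg (hh1.trans hh) (sub_nonneg.2 hle)]
  have hdiff : (d - e0) * (1 + γ * p1 - γ * p0) = γ * (u + v - B) := by
    rw [hu, hv]
    linear_combination hd0 - hflow - γ * p1 * hsum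
  have hde : d - e0 ≤ 0 := by
    refine nonpos_of_mul_nonpos_left ?_ hE
    rw [hdiff]
    exact mul_nonpos_of_nonneg_of_nonpos hγ0 (by linarith)
  have hk1 := mul_nonpos_of_nonneg_of_nonpos hG hde
  have hk2 : h0 * u + h1 * v ≤ h0 * B := by
    linarith [mul_nonneg hh1 (sub_nonneg.2 huv), mul_nonneg (sub_nonneg.2 hh) (sub_nonneg.2 huB)]
  have he : e1 = 1 - e0 := by linarith
  calc e0 * binEnt x0 + e1 * binEnt x1
      ≤ e0 * (H0 - h0 * (x0 - a0)) + e1 * (H1 - h1 * (x1 - p1)) := add_le_add hT0 hT1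
    _ = H1 - e0 * (H1 - H0 + h0 * (p0 - a0)) + (h0 * u + h1 * v) := by
        rw [hu, hv, he]; ring
    _ ≤ H1 - d * (H1 - H0 + h0 * (p0 - a0)) + h0 * B := by linarith
    _ = d * H0 + (1 - d) * H1 := by rw [← hdB]; ring
end

section
/- (Theorem 3, highly-constrained regime, case p0+p1 ≥ 1.) Let p0, p1 ∈ (0,1) with p0 < 1/2 ≤ p1 and p0 + p1 ≥ 1, γ ∈ [0,1), δ ∈ (0,1). Let d0^γ = (1−γ)δ, η1⁻(b) = ((b/2)(1−γp0) − p1(1−γp0−d0^γ)) / (−(1−γp0−d0^γ) − γ·b/2), and b_l' = 2·((1−γp0−d0^γ)/(1−γp0+γψ1))·(p1−ψ1), where ψ1 ∈ [1/2, p1] solves Φ₊(p0) = Φ₋(ψ1). If 0 ≤ b < b_l', then the tuple (a0, a1, d0, d1) with a0 = p0, a1 = η1⁻(b), d0 = D0(a0,a1), d1 = D1(a0,a1) is feasible for problem P2 and attains the maximum of P2: every feasible tuple has objective value at most F(a0, a1, d0, d1). -/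
/-- The function `Φ₊`. -/
noncomputable def PhiP (p0 p1 γ a : ℝ) : ℝ :=
  (1 + γ * p0 + γ * p1) * Real.log ((1 - a) / a) - 2 * γ * Real.log (1 - a)

/-- The function `Φ₋`. -/
noncomputable def PhiM (p0 p1 γ a : ℝ) : ℝ :=
  (-1 + γ * p0 + γ * p1) * Real.log ((1 - a) / a) - 2 * γ * Real.log (1 - a)

/-- The cost map `m(a0, a1) = d0·(a0 − p0) + d1·(p1 − a1)`. -/
noncomputable def mCost (p0 p1 γ δ a0 a1 : ℝ) : ℝ :=
  D0 γ δ a0 a1 * (a0 - p0) + D1 γ δ a0 a1 * (p1 - a1)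

/-- The set `S_b` of Theorem 3. -/
def SetSb (p0 p1 γ δ b : ℝ) : Set (ℝ × ℝ) :=
  {q : ℝ × ℝ | q.1 ∈ Set.Icc p0 (1/2) ∧ q.2 ∈ Set.Icc (1/2) p1 ∧
    PhiM p0 p1 γ q.2 = PhiP p0 p1 γ q.1 ∧ mCost p0 p1 γ δ q.1 q.2 = b / 2}

/-- Scalar Gibbs inequality: `x log y - x log x ≤ y - x`. -/
theorem mul_log_sub_mul_log_le_sub {x y : ℝ} (hx : 0 ≤ x) (hy : 0 < y) :
    x * Real.log y - x * Real.log x ≤ y - x := by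
  rcases hx.eq_or_lt with rfl | hx
  · simpa using hy.le
  · have h := mul_le_mul_of_nonneg_left (Real.log_le_sub_one_of_pos (div_pos hy hx)) hx.le
    rw [Real.log_div hy.ne' hx.ne', mul_sub, mul_sub, mul_div_cancel₀ _ hx.ne'] at h
    linarith

/-- The binary entropy is bounded by the cross-entropy, its tangent line at `c`. -/
theorem binEnt_le_crossEntropy_s9 {a c : ℝ} (ha : a ∈ Set.Icc (0:ℝ) 1) (hc : c ∈ Set.Ioo (0:ℝ) 1) :
    binEnt a ≤ -Real.log (1 - c) + a * (Real.log (1 - c) - Real.log c) := by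
  have h₀ := mul_log_sub_mul_log_le_sub ha.1 hc.1
  have h₁ := mul_log_sub_mul_log_le_sub (sub_nonneg.2 ha.2) (sub_pos.2 hc.2)
  unfold binEnt
  linarith

/-- On `[1/2, 1)` the decrease of `log (1 - x)` dominates the increase of `log x`. -/
theorem log_sub_log_le_log_one_sub_sub {x y : ℝ} (hx : 1 / 2 ≤ x) (hxy : x ≤ y) (hy : y < 1) :
    Real.log y - Real.log x ≤ Real.log (1 - x) - Real.log (1 - y) := by
  have hx0 : 0 < x := by linarith
  have hy0 : 0 < y := by linarith
  have hx1 : 0 < 1 - x := by linarith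
  have hy1 : 0 < 1 - y := by linarith
  rw [sub_le_sub_iff, ← Real.log_mul hy0.ne' hy1.ne', ← Real.log_mul hx1.ne' hx0.ne']
  exact Real.log_le_log (mul_pos hy0 hy1) (by nlinarith)

theorem PhiM_le_PhiM {p0 p1 γ x y : ℝ} (hγ0 : 0 ≤ γ)
    (hγsum : 0 ≤ 1 + γ * (1 - (p0 + p1))) (hx : 1 / 2 ≤ x) (hxy : x ≤ y) (hy : y < 1) :
    PhiM p0 p1 γ x ≤ PhiM p0 p1 γ y := by
  have hX := log_sub_log_le_log_one_sub_sub hx hxy hy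
  have hY := Real.log_le_log (by linarith) hxy
  unfold PhiM
  rw [Real.log_div (by linarith) (by linarith), Real.log_div (by linarith) (by linarith)]
  have h₁ : 0 ≤ 1 + γ * (2 - (p0 + p1)) := by linarith
  nlinarith [mul_nonneg h₁ (sub_nonneg.2 hX), mul_nonneg hγsum (sub_nonneg.2 hY)]

/-- Weak duality for P2: a certificate of KKT multipliers `l` (flow), `m` (mass) and `n` (budget,
with signed share `t` in state `0`) at `(p0, c)` bounds the objective. -/
theorem objP2_le_of_multipliers {p0 p1 γ δ b c l m n t a0 a1 d0 d1 : ℝ}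
    (hp0 : p0 ∈ Set.Ioo (0:ℝ) 1) (hc : c ∈ Set.Ioo (0:ℝ) 1)
    (hx0 : Real.log (1 - p0) - Real.log p0 = -l * γ + t)
    (hd0 : -Real.log (1 - p0) = l + m - t * p0)
    (hx1 : Real.log (1 - c) - Real.log c = -l * γ - n)
    (hd1 : -Real.log (1 - c) = m + n * p1)
    (ht : |t| ≤ n) (h : FeasP2 p0 p1 γ δ b a0 a1 d0 d1) :
    objP2 a0 a1 d0 d1 ≤ l * ((1 - γ) * δ) + m + n * (b / 2) := by
  obtain ⟨ha0, ha1, hd0', hd1', hflow, hmass, hbud⟩ := h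
  have h₀ := mul_le_mul_of_nonneg_left (binEnt_le_crossEntropy_s9 ha0 hp0) hd0'
  have h₁ := mul_le_mul_of_nonneg_left (binEnt_le_crossEntropy_s9 ha1 hc) hd1'
  rw [hx0, hd0] at h₀
  rw [hx1, hd1] at h₁
  have hn : 0 ≤ n := (abs_nonneg t).trans ht
  have ht' : t * (a0 - p0) ≤ n * |a0 - p0| :=
    (le_abs_self _).trans (by rw [abs_mul]; gcongr)
  have hn' : n * (p1 - a1) ≤ n * |a1 - p1| := by
    gcongr
    rw [abs_sub_comm]
    exact le_abs_self _
  have e₀ := mul_le_mul_of_nonneg_left ht' hd0'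
  have e₁ := mul_le_mul_of_nonneg_left hn' hd1'
  have e₂ := mul_le_mul_of_nonneg_left hbud hn
  rw [← hflow]
  have hm : m = m * (d0 + d1) := by rw [hmass, mul_one]
  unfold objP2
  linarith

/-- Theorem 3, highly-constrained regime, case `p0 + p1 ≥ 1` (`0 ≤ b < b_l'`):
the optimal policy is `a0 = p0`, `a1 = η1⁻(b)`. -/
theorem thm3_highly_constrained_sum_ge_one
    (p0 p1 γ δ b : ℝ)
    (hp0 : p0 ∈ Set.Ioo (0:ℝ) 1) (hp1 : p1 ∈ Set.Ioo (0:ℝ) 1)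
    (hp0half : p0 < 1/2) (hp1half : 1/2 ≤ p1) (hsum : 1 ≤ p0 + p1)
    (hγ : γ ∈ Set.Ico (0:ℝ) 1) (hδ : δ ∈ Set.Ioo (0:ℝ) 1)
    (ψ1 : ℝ)
    (hψ1 : ψ1 ∈ Set.Icc (1/2) p1 ∧ PhiP p0 p1 γ p0 = PhiM p0 p1 γ ψ1)
    (hb0 : 0 ≤ b)
    (hbl : b < 2 * ((1 - γ * p0 - (1 - γ) * δ) / (1 - γ * p0 + γ * ψ1)) * (p1 - ψ1))
    (a1 : ℝ)
    (ha1 : a1 = ((b / 2) * (1 - γ * p0) - p1 * (1 - γ * p0 - (1 - γ) * δ)) /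
        (-(1 - γ * p0 - (1 - γ) * δ) - γ * (b / 2))) :
    FeasP2 p0 p1 γ δ b p0 a1 (D0 γ δ p0 a1) (D1 γ δ p0 a1) ∧
      ∀ a0' a1' d0' d1' : ℝ, FeasP2 p0 p1 γ δ b a0' a1' d0' d1' →
        objP2 a0' a1' d0' d1' ≤ objP2 p0 a1 (D0 γ δ p0 a1) (D1 γ δ p0 a1) := by
  obtain ⟨hp00, hp01⟩ := hp0
  obtain ⟨hp10, hp11⟩ := hp1
  obtain ⟨hγ0, hγ1⟩ := hγ
  obtain ⟨hδ0, hδ1⟩ := hδ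
  obtain ⟨⟨hψh, hψp⟩, hΦ⟩ := hψ1
  have hγp : γ * p0 ≤ γ := mul_le_of_le_one_right hγ0 hp01.le
  have hδγ : (1 - γ) * δ < 1 - γ := mul_lt_of_lt_one_right (by linarith) hδ1
  have hδγ0 : 0 < (1 - γ) * δ := mul_pos (by linarith) hδ0
  set q := (1 - γ) * δ with hq
  have hK : 0 < 1 - γ * p0 - q := by linarith
  have hγψ : 0 ≤ γ * ψ1 := mul_nonneg hγ0 (by linarith)
  have hbl' : b / 2 * (1 - γ * p0 + γ * ψ1) < (1 - γ * p0 - q) * (p1 - ψ1) := by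
    rw [← lt_div_iff₀ (by linarith)]
    calc b / 2 < (2 * ((1 - γ * p0 - q) / (1 - γ * p0 + γ * ψ1)) * (p1 - ψ1)) / 2 := by linarith
      _ = _ := by ring
  have hγb : 0 ≤ γ * (b / 2) := by positivity
  have hden : 0 < 1 - γ * p0 - q + γ * (b / 2) := by linarith
  have ha1' : a1 * (1 - γ * p0 - q + γ * (b / 2)) =
      p1 * (1 - γ * p0 - q) - b / 2 * (1 - γ * p0) := by
    rw [eq_div_iff (by linarith)] at ha1
    linarith
  have hψa : ψ1 < a1 := by
    refine lt_of_mul_lt_mul_right ?_ hden.le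
    rw [ha1']
    linarith
  have hap : a1 ≤ p1 := by
    refine le_of_mul_le_mul_right ?_ hden
    rw [ha1']
    nlinarith [mul_nonneg hγb hp10.le, mul_nonneg hb0 (by linarith : 0 ≤ 1 - γ * p0)]
  have ha0 : 0 < a1 := by linarith
  have ha1lt : a1 < 1 := by linarith
  have hγa : 0 ≤ γ * a1 := mul_nonneg hγ0 ha0.le
  have hN : 0 < 1 - γ * p0 + γ * a1 := by linarith
  have hD0 : D0 γ δ p0 a1 * (1 - γ * p0 + γ * a1) = q + γ * a1 := div_mul_cancel₀ _ hN.ne'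
  have hD1 : D1 γ δ p0 a1 = (1 - γ * p0 - q) / (1 - γ * p0 + γ * a1) := by
    rw [eq_div_iff hN.ne', D1, sub_mul, hD0]
    ring
  have hD1' : D1 γ δ p0 a1 = 1 - D0 γ δ p0 a1 := rfl
  have hbud : D1 γ δ p0 a1 * (p1 - a1) = b / 2 := by
    rw [hD1, div_mul_eq_mul_div, div_eq_iff hN.ne']
    linarith
  have hflow : (1 - γ * p0) * D0 γ δ p0 a1 - γ * a1 * D1 γ δ p0 a1 = q := by
    rw [hD1']
    linarith
  refine ⟨⟨⟨hp00.le, hp01.le⟩, ⟨ha0.le, ha1lt.le⟩, by unfold D0; positivity,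
    by rw [hD1]; positivity, hflow, by rw [hD1']; ring, ?_⟩, ?_⟩
  · rw [sub_self, abs_zero, abs_sub_comm, abs_of_nonneg (by linarith)]
    linarith
  intro a0' a1' d0' d1' hfeas
  have hs : 0 < 1 + γ * (p1 - p0) := by
    have := mul_nonneg hγ0 (by linarith : 0 ≤ p1 - p0)
    linarith
  have hΦa : PhiP p0 p1 γ p0 ≤ PhiM p0 p1 γ a1 :=
    hΦ.trans_le (PhiM_le_PhiM hγ0 (by nlinarith) hψh hψa.le ha1lt)
  unfold PhiP PhiM at hΦa
  rw [Real.log_div (by linarith) (by linarith), Real.log_div (by linarith) (by linarith)] at hΦa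
  have hlog : Real.log p0 ≤ Real.log a1 := Real.log_le_log hp00 (by linarith)
  have hlog' : Real.log (1 - a1) ≤ Real.log (1 - p0) :=
    Real.log_le_log (by linarith) (by linarith)
  obtain ⟨l, hl⟩ : ∃ l, l * (1 + γ * (p1 - p0)) = -Real.log (1 - p0) + Real.log (1 - a1)
      - p1 * (Real.log (1 - a1) - Real.log a1) + p0 * (Real.log (1 - p0) - Real.log p0) :=
    ⟨_, div_mul_cancel₀ _ hs.ne'⟩
  have htn : (Real.log (1 - p0) - Real.log p0) + (Real.log (1 - a1) - Real.log a1)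
      + 2 * (l * γ) ≤ 0 := by
    refine nonpos_of_mul_nonpos_left ?_ hs
    linear_combination hΦa + 2 * γ * hl
  obtain ⟨t, ht⟩ : ∃ t, t = Real.log (1 - p0) - Real.log p0 + l * γ := ⟨_, rfl⟩
  obtain ⟨n, hn⟩ : ∃ n, n = -(Real.log (1 - a1) - Real.log a1) - l * γ := ⟨_, rfl⟩
  obtain ⟨m, hm⟩ : ∃ m, m = -Real.log (1 - a1) - n * p1 := ⟨_, rfl⟩
  have hm' : -Real.log (1 - p0) = l + m - t * p0 := by
    rw [hm, hn, ht]
    linarith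
  refine (objP2_le_of_multipliers (c := a1) (l := l) (m := m) (n := n) (t := t) ⟨hp00, hp01⟩
    ⟨ha0, ha1lt⟩ (by linarith) hm' (by linarith) (by linarith)
    (abs_le.2 ⟨by linarith, by linarith⟩) hfeas).trans_eq ?_
  have e₀ : binEnt p0 = l + m - t * p0 + p0 * (t - l * γ) := by
    rw [← hm', ht, binEnt]
    ring
  have e₁ : binEnt a1 = m + n * p1 + a1 * (-n - l * γ) := by
    rw [hm, hn, binEnt]
    ring
  rw [objP2, e₀, e₁, ← hbud, ← hq, ← hflow, hD1']
  ring
end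

section
/- (Theorem 3, highly-constrained regime, case p0+p1 < 1.) Let p0, p1 ∈ (0,1) with p0 < 1/2 ≤ p1 and p0 + p1 < 1, γ ∈ [0,1), δ ∈ (0,1). Let d0^γ = (1−γ)δ, η0⁺(b) = ((b/2)(1+γp1) + p0(d0^γ+γp1)) / ((γp1+d0^γ) + γ·b/2), and b_l' = 2·((d0^γ+γp1)/(1−γψ0+γp1))·(ψ0−p0), where ψ0 ∈ [p0, 1/2] solves Φ₊(ψ0) = Φ₋(p1). If 0 ≤ b < b_l', then the tuple (a0, a1, d0, d1) with a0 = η0⁺(b), a1 = p1, d0 = D0(a0,a1), d1 = D1(a0,a1) is feasible for problem P2 and attains the maximum of P2: every feasible tuple has objective value at most F(a0, a1, d0, d1). -/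
theorem mul_log_sub_mul_log_le {a s : ℝ} (ha : 0 ≤ a) (hs : 0 < s) :
    a * Real.log s - a * Real.log a ≤ s - a := by
  rcases ha.eq_or_lt with rfl | ha
  · simpa using hs.le
  · have h := Real.log_le_sub_one_of_pos (div_pos hs ha)
    rw [Real.log_div hs.ne' ha.ne'] at h
    have h' := mul_le_mul_of_nonneg_left h ha.le
    have e : a * (s / a - 1) = s - a := by field_simp
    linarith

/-- The binary entropy is bounded by the cross entropy (Gibbs' inequality). -/
theorem binEnt_le_cross {a s : ℝ} (ha : a ∈ Set.Icc (0:ℝ) 1) (hs : s ∈ Set.Ioo (0:ℝ) 1) :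
    binEnt a ≤ a * (Real.log (1 - s) - Real.log s) - Real.log (1 - s) := by
  have h1 := mul_log_sub_mul_log_le ha.1 hs.1
  have h2 := mul_log_sub_mul_log_le (sub_nonneg.2 ha.2) (sub_pos.2 hs.2)
  unfold binEnt
  linarith

theorem PhiP_anti {p0 p1 γ a ψ : ℝ} (hp : 0 ≤ p0 + p1) (hγ : γ ∈ Set.Ico (0:ℝ) 1)
    (ha : 0 < a) (haψ : a ≤ ψ) (hψ : ψ ≤ 1 / 2) :
    PhiP p0 p1 γ ψ ≤ PhiP p0 p1 γ a := by
  have hψ0 : 0 < ψ := ha.trans_le haψ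
  have h1a : 0 < 1 - a := by linarith
  have h1ψ : 0 < 1 - ψ := by linarith
  have hlog : Real.log a ≤ Real.log ψ := Real.log_le_log ha haψ
  have hlog1 : Real.log (1 - ψ) ≤ Real.log (1 - a) := Real.log_le_log h1ψ (by linarith)
  have hprod : Real.log a + Real.log (1 - a) ≤ Real.log ψ + Real.log (1 - ψ) := by
    rw [← Real.log_mul ha.ne' h1a.ne', ← Real.log_mul hψ0.ne' h1ψ.ne']
    exact Real.log_le_log (mul_pos ha h1a) (by nlinarith)
  have hc : 0 ≤ 1 - γ + γ * (p0 + p1) :=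
    add_nonneg (by linarith [hγ.2]) (mul_nonneg hγ.1 hp)
  have e1 := mul_le_mul_of_nonneg_left
    (show Real.log (1 - ψ) - Real.log ψ ≤ Real.log (1 - a) - Real.log a by linarith) hc
  have e2 := mul_le_mul_of_nonneg_left hprod hγ.1
  unfold PhiP
  rw [Real.log_div h1a.ne' ha.ne', Real.log_div h1ψ.ne' hψ0.ne']
  linarith

/-- A Lagrangian certificate for P2 with dual variables `ν` (normalisation), `μ` (flow)
and `l`, `l'` (budget), where the entropies are linearised at `s0` and `s1`. -/
theorem objP2_le_of_dual {p0 p1 γ δ b s0 s1 ν μ l l' a0 a1 d0 d1 : ℝ}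
    (hs0 : s0 ∈ Set.Ioo (0:ℝ) 1) (hs1 : s1 ∈ Set.Ioo (0:ℝ) 1)
    (hl : Real.log (1 - s0) - Real.log s0 = l - γ * μ)
    (hl' : Real.log (1 - s1) - Real.log s1 = l' - γ * μ)
    (hν0 : -Real.log (1 - s0) = ν + μ - l * p0)
    (hν1 : -Real.log (1 - s1) = ν - l' * p1)
    (hle : |l'| ≤ l) (h : FeasP2 p0 p1 γ δ b a0 a1 d0 d1) :
    objP2 a0 a1 d0 d1 ≤ ν + μ * ((1 - γ) * δ) + l * (b / 2) := by
  obtain ⟨h0, h1, hd0, hd1, hflow, hsum, hcost⟩ := h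
  have hl0 : 0 ≤ l := (abs_nonneg _).trans hle
  have g0 := mul_le_mul_of_nonneg_left (binEnt_le_cross h0 hs0) hd0
  have g1 := mul_le_mul_of_nonneg_left (binEnt_le_cross h1 hs1) hd1
  have c0 : l * (a0 - p0) ≤ l * |a0 - p0| := mul_le_mul_of_nonneg_left (le_abs_self _) hl0
  have c1 : l' * (a1 - p1) ≤ l * |a1 - p1| :=
    calc l' * (a1 - p1) ≤ |l' * (a1 - p1)| := le_abs_self _
      _ = |l'| * |a1 - p1| := abs_mul _ _
      _ ≤ l * |a1 - p1| := mul_le_mul_of_nonneg_right hle (abs_nonneg _)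
  have c0' := mul_le_mul_of_nonneg_left c0 hd0
  have c1' := mul_le_mul_of_nonneg_left c1 hd1
  have hb := mul_le_mul_of_nonneg_left hcost hl0
  rw [hl, sub_eq_add_neg _ (Real.log (1 - s0)), hν0] at g0
  rw [hl', sub_eq_add_neg _ (Real.log (1 - s1)), hν1] at g1
  have e : d0 * (a0 * (l - γ * μ) + (ν + μ - l * p0)) + d1 * (a1 * (l' - γ * μ) + (ν - l' * p1))
      = ν * (d0 + d1) + μ * ((1 - γ * a0) * d0 - γ * a1 * d1) + d0 * (l * (a0 - p0))
        + d1 * (l' * (a1 - p1)) := by ring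
  rw [hsum, hflow] at e
  unfold objP2
  linarith

/-- Theorem 3, highly-constrained regime, case `p0 + p1 < 1` (`0 ≤ b < b_l'`):
the optimal policy is `a0 = η0⁺(b)`, `a1 = p1`. -/
theorem thm3_highly_constrained_sum_lt_one
    (p0 p1 γ δ b : ℝ)
    (hp0 : p0 ∈ Set.Ioo (0:ℝ) 1) (hp1 : p1 ∈ Set.Ioo (0:ℝ) 1)
    (hp0half : p0 < 1/2) (hp1half : 1/2 ≤ p1) (hsum : p0 + p1 < 1)
    (hγ : γ ∈ Set.Ico (0:ℝ) 1) (hδ : δ ∈ Set.Ioo (0:ℝ) 1)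
    (ψ0 : ℝ)
    (hψ0 : ψ0 ∈ Set.Icc p0 (1/2) ∧ PhiP p0 p1 γ ψ0 = PhiM p0 p1 γ p1)
    (hb0 : 0 ≤ b)
    (hbl : b < 2 * (((1 - γ) * δ + γ * p1) / (1 - γ * ψ0 + γ * p1)) * (ψ0 - p0))
    (a0 : ℝ)
    (ha0 : a0 = ((b / 2) * (1 + γ * p1) + p0 * ((1 - γ) * δ + γ * p1)) /
        ((γ * p1 + (1 - γ) * δ) + γ * (b / 2))) :
    FeasP2 p0 p1 γ δ b a0 p1 (D0 γ δ a0 p1) (D1 γ δ a0 p1) ∧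
      ∀ a0' a1' d0' d1' : ℝ, FeasP2 p0 p1 γ δ b a0' a1' d0' d1' →
        objP2 a0' a1' d0' d1' ≤ objP2 a0 p1 (D0 γ δ a0 p1) (D1 γ δ a0 p1) := by
  obtain ⟨hp0pos, hp0lt⟩ := hp0
  obtain ⟨hγ0, hγ1⟩ := hγ
  obtain ⟨⟨hpψ, hψhalf⟩, hψ⟩ := hψ0
  have hp1pos : 0 < p1 := hp1.1
  set N := (1 - γ) * δ + γ * p1 with hN
  have hNpos : 0 < N :=
    add_pos_of_pos_of_nonneg (mul_pos (by linarith) hδ.1) (mul_nonneg hγ0 hp1pos.le)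
  have hT : 0 < N + γ * (b / 2) := by positivity
  have hK : 0 < 1 - γ * p0 + γ * p1 := by nlinarith
  have hKψ : 0 < 1 - γ * ψ0 + γ * p1 := by nlinarith
  have ha0' : a0 * (N + γ * (b / 2)) = (b / 2) * (1 + γ * p1) + p0 * N := by
    rw [ha0, add_comm (γ * p1), ← hN, div_mul_cancel₀ _ hT.ne']
  have hbψ : b / 2 * (1 - γ * ψ0 + γ * p1) < N * (ψ0 - p0) := by
    have e : 2 * (N / (1 - γ * ψ0 + γ * p1)) * (ψ0 - p0)
        = 2 * (N * (ψ0 - p0)) / (1 - γ * ψ0 + γ * p1) := by ring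
    rw [e, lt_div_iff₀ hKψ] at hbl
    linarith
  have ha0ψ : a0 ≤ ψ0 := le_of_mul_le_mul_right (by linarith) hT
  have hp0a0 : p0 ≤ a0 := le_of_mul_le_mul_right (by nlinarith [mul_nonneg hb0 hK.le]) hT
  have ha0pos : 0 < a0 := hp0pos.trans_le hp0a0
  have ha0lt : a0 < 1 := by linarith
  have hKa : 0 < 1 - γ * a0 + γ * p1 := by nlinarith
  set x := D0 γ δ a0 p1 with hx
  have hxK : x * (1 - γ * a0 + γ * p1) = N := by
    rw [hx, D0, ← hN, div_mul_cancel₀ _ hKa.ne']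
  have hx0 : 0 ≤ x := (div_pos hNpos hKa).le
  have hx1 : x ≤ 1 := by
    refine le_of_mul_le_mul_right ?_ hKa
    have h1 : (1 - γ) * δ ≤ (1 - γ) * 1 := mul_le_mul_of_nonneg_left hδ.2.le (by linarith)
    have h2 : γ * a0 ≤ γ * 1 := mul_le_mul_of_nonneg_left ha0lt.le hγ0
    linarith
  have hcost : x * (a0 - p0) = b / 2 := by
    refine mul_right_cancel₀ hKa.ne' ?_
    rw [mul_right_comm, hxK]
    linarith
  have hflow : (1 - γ * a0) * x - γ * p1 * (1 - x) = (1 - γ) * δ := by linarith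
  refine ⟨⟨⟨ha0pos.le, ha0lt.le⟩, ⟨hp1.1.le, hp1.2.le⟩, hx0, sub_nonneg.2 hx1, hflow,
    by rw [D1]; ring, ?_⟩, ?_⟩
  · rw [abs_of_nonneg (sub_nonneg.2 hp0a0), sub_self, abs_zero]
    linarith
  intro a0' a1' d0' d1' h
  have hΦ := PhiP_anti (add_pos hp0pos hp1pos).le ⟨hγ0, hγ1⟩ ha0pos ha0ψ hψhalf
  rw [hψ, PhiP, PhiM, Real.log_div (by linarith) ha0pos.ne',
    Real.log_div (by linarith [hp1.2]) hp1pos.ne'] at hΦ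
  have hA0 : 0 ≤ Real.log (1 - a0) - Real.log a0 :=
    sub_nonneg.2 (Real.log_le_log ha0pos (by linarith))
  have hB0 : Real.log (1 - p1) - Real.log p1 ≤ 0 :=
    sub_nonpos.2 (Real.log_le_log (by linarith [hp1.2]) (by linarith))
  have eF : objP2 a0 p1 x (D1 γ δ a0 p1)
      = x * (a0 * (Real.log (1 - a0) - Real.log a0) - Real.log (1 - a0))
        + (1 - x) * (p1 * (Real.log (1 - p1) - Real.log p1) - Real.log (1 - p1)) := by
    rw [objP2, D1, ← hx, binEnt, binEnt]; ring
  rw [eF]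
  set A := Real.log (1 - a0) - Real.log a0
  set B := Real.log (1 - p1) - Real.log p1
  obtain ⟨μ, hμ⟩ : ∃ μ, μ * (1 - γ * p0 + γ * p1)
      = -Real.log (1 - a0) + Real.log (1 - p1) + p0 * A - p1 * B :=
    ⟨_, div_mul_cancel₀ _ hK.ne'⟩
  have hsumnn : 0 ≤ A + B + 2 * γ * μ := by
    refine nonneg_of_mul_nonneg_left ?_ hK
    have e : (A + B + 2 * γ * μ) * (1 - γ * p0 + γ * p1)
        = (A + B) * (1 - γ * p0 + γ * p1) + 2 * γ * (μ * (1 - γ * p0 + γ * p1)) := by ring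
    rw [e, hμ]
    linarith
  have key := objP2_le_of_dual (s0 := a0) (s1 := p1) (l := A + γ * μ) (l' := B + γ * μ) (μ := μ)
    (ν := -Real.log (1 - p1) + (B + γ * μ) * p1)
    ⟨ha0pos, ha0lt⟩ hp1 (by ring) (by ring) (by linarith) (by ring)
    (abs_le.2 ⟨by linarith, by linarith⟩) h
  refine key.trans (le_of_eq ?_)
  rw [← hcost, ← hflow]
  linear_combination x * hμ
end

section
/- (Monotonicity of Φ₊ and Φ₋.) Let p0, p1 ∈ [0,1] and γ ∈ [0,1). Then Φ₊ is strictly decreasing on the interval (0, 1/2], Φ₋ is strictly increasing on the interval [1/2, 1), and Φ₊(1/2) = Φ₋(1/2) = 2γ·log 2. -/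
/-- The common derivative formula for `Φ₊` and `Φ₋`. -/
theorem hasDerivAt_mul_log_odds_sub (c γ : ℝ) {a : ℝ} (ha0 : 0 < a) (ha1 : a < 1) :
    HasDerivAt (fun x => c * Real.log ((1 - x) / x) - 2 * γ * Real.log (1 - x))
      ((2 * γ * a - c) / (a * (1 - a))) a := by
  have h1 : 1 - a ≠ 0 := by linarith
  have hsub : HasDerivAt (fun x : ℝ => 1 - x) (-1) a := (hasDerivAt_id a).const_sub 1
  have hodds := ((hsub.fun_div (hasDerivAt_id a) ha0.ne').log (div_ne_zero h1 ha0.ne')).const_mul c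
  refine (hodds.fun_sub ((hsub.log h1).const_mul (2 * γ))).congr_deriv ?_
  simp only [id]
  field_simp
  ring

/-- `Φ₊` is strictly decreasing on `(0, 1/2]`, `Φ₋` is strictly increasing on `[1/2, 1)`,
and they intersect at `1/2` with common value `2γ·log 2`. -/
theorem PhiP_strictAnti_PhiM_strictMono
    (p0 p1 γ : ℝ)
    (hp0 : p0 ∈ Set.Icc (0:ℝ) 1) (hp1 : p1 ∈ Set.Icc (0:ℝ) 1)
    (hγ : γ ∈ Set.Ico (0:ℝ) 1) :
    StrictAntiOn (PhiP p0 p1 γ) (Set.Ioc 0 (1/2)) ∧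
      StrictMonoOn (PhiM p0 p1 γ) (Set.Ico (1/2) 1) ∧
      PhiP p0 p1 γ (1/2) = 2 * γ * Real.log 2 ∧
      PhiM p0 p1 γ (1/2) = 2 * γ * Real.log 2 := by
  obtain ⟨hp0, hp0'⟩ := hp0
  obtain ⟨hp1, hp1'⟩ := hp1
  obtain ⟨hγ, hγ'⟩ := hγ
  have hlog : Real.log (1 - 1 / 2) = -Real.log 2 := by
    rw [← Real.log_inv]
    norm_num
  refine ⟨?_, ?_, ?_, ?_⟩
  · have hderiv : ∀ a ∈ Set.Ioc (0 : ℝ) (1 / 2), HasDerivAt (PhiP p0 p1 γ) _ a := fun a ha =>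
      hasDerivAt_mul_log_odds_sub (1 + γ * p0 + γ * p1) γ ha.1 (by linarith [ha.2])
    refine strictAntiOn_of_deriv_neg (convex_Ioc 0 (1 / 2))
      (fun a ha => (hderiv a ha).continuousAt.continuousWithinAt) fun a ha => ?_
    have ha' := interior_subset ha
    rw [(hderiv a ha').deriv]
    obtain ⟨h0, h1⟩ := ha'
    exact div_neg_of_neg_of_pos
      (by nlinarith [mul_nonneg hγ hp0, mul_nonneg hγ hp1, mul_le_mul_of_nonneg_left h1 hγ])
      (mul_pos h0 (by linarith))
  · have hderiv : ∀ a ∈ Set.Ico (1 / 2 : ℝ) 1, HasDerivAt (PhiM p0 p1 γ) _ a := fun a ha =>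
      hasDerivAt_mul_log_odds_sub (-1 + γ * p0 + γ * p1) γ (by linarith [ha.1]) ha.2
    refine strictMonoOn_of_deriv_pos (convex_Ico (1 / 2) 1)
      (fun a ha => (hderiv a ha).continuousAt.continuousWithinAt) fun a ha => ?_
    have ha' := interior_subset ha
    rw [(hderiv a ha').deriv]
    obtain ⟨h0, h1⟩ := ha'
    exact div_pos
      (by nlinarith [mul_le_mul_of_nonneg_left hp0' hγ, mul_le_mul_of_nonneg_left hp1' hγ,
        mul_le_mul_of_nonneg_left h0 hγ])
      (mul_pos (by linarith) (by linarith))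
  · rw [PhiP, hlog]
    norm_num
  · rw [PhiM, hlog]
    norm_num
end
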